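/- (Proposition 4.1, lower bound at a single interface.) Fix γ ∈ (0,∞) and assume W is continuous and satisfies (H1), (H2) and the normalization of the wells. Let ρ > 0, α ∈ ℝ, let J ⊂ ℝ be a bounded open interval, and set U := (α−ρ, α+ρ) × J × I. Let u : U → ℝ³ be Lipschitz and b : U → ℝ³ bounded measurable, both independent of x₃, such that either the 3×3 matrix (∂₁u, ∂₂u, b) equals A a.e. on U ∩ {x₁ > α} and equals B a.e. on U ∩ {x₁ < α}, or it equals B a.e. on U ∩ {x₁ > α} and A a.e. on U ∩ {x₁ < α}. Then for all sequences h_n → 0⁺, ε_n → 0⁺ with h_n/ε_n → γ and all C² maps u_n : U → ℝ³ with ∫_U |u_n − u| dx → 0 and ∫_U |h_n⁻¹∂₃u_n − b| dx → 0, one has liminf_{n→∞} F^{h_n}_{ε_n}(u_n, U) ≥ K*_γ · ℒ¹(J). -/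

import Mathlib

open MeasureTheory Filter Topology ENNReal NNReal Set

noncomputable section

/-- Vectors in ℝ³. -/
abbrev V3 := Fin 3 → ℝ

/-- 3×3 matrices, represented as the triple of their columns. -/
abbrev M33 := Fin 3 → V3

/-- Euclidean norm on ℝ³. -/
def vnorm (v : V3) : ℝ := Real.sqrt (∑ i, (v i) ^ 2)

/-- Frobenius (Euclidean) norm on 3×3 matrices. -/
def mnorm (ξ : M33) : ℝ := Real.sqrt (∑ j, ∑ i, (ξ j i) ^ 2)

/-- dist(ξ,{A,B}). -/
def mdist (A B ξ : M33) : ℝ := min (mnorm (ξ - A)) (mnorm (ξ - B))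

/-- Spatial points of ℝ³ = ℝ × ℝ × ℝ. -/
abbrev Pt := ℝ × ℝ × ℝ

/-- Directional partial derivative of a map `u : ℝ³ → ℝ³`. -/
def pd (e : Pt) (u : Pt → V3) (x : Pt) : V3 := fderiv ℝ u x e

def e1 : Pt := (1, 0, 0)
def e2 : Pt := (0, 1, 0)
def e3 : Pt := (0, 0, 1)

/-- Rescaled gradient ∇_h u = (∂₁u, ∂₂u, h⁻¹ ∂₃u), as a 3×3 matrix of columns. -/
def gradh (h : ℝ) (u : Pt → V3) (x : Pt) : M33 :=
  ![pd e1 u x, pd e2 u x, h⁻¹ • pd e3 u x]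

/-- Squared rescaled Hessian |∇²_h u|². -/
def hessh (h : ℝ) (u : Pt → V3) (x : Pt) : ℝ :=
  (vnorm (pd e1 (pd e1 u) x)) ^ 2 + (vnorm (pd e2 (pd e2 u) x)) ^ 2
    + (h⁻¹) ^ 4 * (vnorm (pd e3 (pd e3 u) x)) ^ 2
    + 2 * (vnorm (pd e2 (pd e1 u) x)) ^ 2
    + 2 * (h⁻¹) ^ 2 * (vnorm (pd e3 (pd e1 u) x)) ^ 2
    + 2 * (h⁻¹) ^ 2 * (vnorm (pd e3 (pd e2 u) x)) ^ 2

/-- The energy F^h_ε(u, S) = ∫_S (1/ε) W(∇_h u) + ε |∇²_h u|², valued in [0,∞]. -/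
def F (W : M33 → ℝ) (h ε : ℝ) (u : Pt → V3) (S : Set Pt) : ℝ≥0∞ :=
  ∫⁻ x in S, ENNReal.ofReal (ε⁻¹ * W (gradh h u x) + ε * hessh h u x)

/-- Hypothesis (H1): W ≥ 0, {W = 0} = {A, B}, A ≠ B, and A' − B' = 2 a ⊗ ν̄ for
some a ∈ ℝ³ and a unit vector ν̄ ∈ ℝ². -/
def H1 (W : M33 → ℝ) (A B : M33) : Prop :=
  (∀ ξ, 0 ≤ W ξ) ∧ (∀ ξ, W ξ = 0 ↔ ξ = A ∨ ξ = B) ∧ A ≠ B ∧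
    ∃ (a : V3) (ν : ℝ × ℝ), ν.1 ^ 2 + ν.2 ^ 2 = 1 ∧
      A 0 - B 0 = (2 * ν.1) • a ∧ A 1 - B 1 = (2 * ν.2) • a

/-- Hypothesis (H2): p-growth from above and below. -/
def H2 (W : M33 → ℝ) (p : ℝ) : Prop :=
  ∃ C > (0 : ℝ), ∀ ξ, C⁻¹ * (mnorm ξ) ^ p - C ≤ W ξ ∧ W ξ ≤ C * (mnorm ξ) ^ p + C

/-- Hypothesis (H3): non-degeneracy near the wells. -/
def H3 (W : M33 → ℝ) (A B : M33) (p : ℝ) : Prop :=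
  ∃ ϱ > (0 : ℝ), ∃ C > (0 : ℝ), ∀ ξ, mdist A B ξ ≤ ϱ →
    C⁻¹ * (mdist A B ξ) ^ p ≤ W ξ ∧ W ξ ≤ C * (mdist A B ξ) ^ p

/-- Hypothesis (H4): W(ξ₁, 0, ξ₃) ≤ W(ξ). -/
def H4 (W : M33 → ℝ) : Prop := ∀ ξ : M33, W ![ξ 0, 0, ξ 2] ≤ W ξ

/-- Normalization of the wells: A = −B, first column of A is a, second column is 0. -/
def Wells (A B : M33) (a : V3) : Prop := A = -B ∧ A 0 = a ∧ A 1 = 0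

/-- ū₀(t) = |t| a. -/
def ub0 (a : V3) (t : ℝ) : V3 := |t| • a

/-- b̄₀(t) = A₃ for t ≥ 0, −A₃ (= B₃) for t < 0. -/
def bb0 (A3 : V3) (t : ℝ) : V3 := if 0 ≤ t then A3 else -A3

/-- u₀(x) = ū₀(x₁). -/
def u0 (a : V3) (x : Pt) : V3 := ub0 a x.1

/-- b₀(x) = b̄₀(x₁). -/
def b0 (A3 : V3) (x : Pt) : V3 := bb0 A3 x.1

/-- The interval I = (−1/2, 1/2). -/
def II : Set ℝ := Set.Ioo (-(1 / 2 : ℝ)) (1 / 2)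

/-- The unit cube Q = I × I × I. -/
def Q3 : Set Pt := II ×ˢ (II ×ˢ II)

/-- J_ρ = (ρ I) × J × I. -/
def Jrho (J : Set ℝ) (ρ : ℝ) : Set Pt := (Set.Ioo (-(ρ / 2)) (ρ / 2)) ×ˢ (J ×ˢ II)

/-- The rescaled thin domain Ω = ω × I. -/
def Om (ω : Set (ℝ × ℝ)) : Set Pt := {x | (x.1, x.2.1) ∈ ω ∧ x.2.2 ∈ II}

/-- L¹ convergence on a set U. -/
def TendsL1 (U : Set Pt) (f : ℕ → Pt → V3) (g : Pt → V3) : Prop :=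
  Tendsto (fun n => ∫⁻ x in U, ENNReal.ofReal (vnorm (f n x - g x))) atTop (nhds 0)

/-- L^q convergence on a set U. -/
def TendsLp (U : Set Pt) (q : ℝ) (f : ℕ → Pt → V3) (g : Pt → V3) : Prop :=
  Tendsto (fun n => ∫⁻ x in U, ENNReal.ofReal ((vnorm (f n x - g x)) ^ q)) atTop (nhds 0)

/-- The localized asymptotic energy 𝓔_γ(J, ρ). -/
def Egam (W : M33 → ℝ) (a A3 : V3) (γ : ℝ) (J : Set ℝ) (ρ : ℝ) : ℝ≥0∞ :=
  sInf { L : ℝ≥0∞ | ∃ (h ε : ℕ → ℝ) (u : ℕ → Pt → V3),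
    (∀ n, 0 < h n) ∧ (∀ n, 0 < ε n) ∧
    Tendsto h atTop (nhds 0) ∧ Tendsto ε atTop (nhds 0) ∧
    Tendsto (fun n => h n / ε n) atTop (nhds γ) ∧
    (∀ n, ContDiffOn ℝ 2 (u n) (Jrho J ρ)) ∧
    TendsL1 (Jrho J ρ) u (u0 a) ∧
    TendsL1 (Jrho J ρ) (fun n x => (h n)⁻¹ • pd e3 (u n) x) (b0 A3) ∧
    L = Filter.liminf (fun n => F W (h n) (ε n) (u n) (Jrho J ρ)) atTop }

/-- K*_γ = 𝓔_γ(I, 1). -/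
def Kstar (W : M33 → ℝ) (a A3 : V3) (γ : ℝ) : ℝ≥0∞ := Egam W a A3 γ II 1

/-- K*_∞ : the analogue of K*_γ for h/ε → ∞, on the unit cube Q. -/
def KstarInf (W : M33 → ℝ) (a A3 : V3) : ℝ≥0∞ :=
  sInf { L : ℝ≥0∞ | ∃ (h ε : ℕ → ℝ) (u : ℕ → Pt → V3),
    (∀ n, 0 < h n) ∧ (∀ n, 0 < ε n) ∧
    Tendsto h atTop (nhds 0) ∧ Tendsto ε atTop (nhds 0) ∧
    Tendsto (fun n => h n / ε n) atTop atTop ∧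
    (∀ n, ContDiffOn ℝ 2 (u n) Q3) ∧
    TendsL1 Q3 u (u0 a) ∧
    TendsL1 Q3 (fun n x => (h n)⁻¹ • pd e3 (u n) x) (b0 A3) ∧
    L = Filter.liminf (fun n => F W (h n) (ε n) (u n) Q3) atTop }

open Classical in
/-- The phase matrix: B on E, A off E. -/
def Mfun (A B : M33) (E : Set (ℝ × ℝ)) (x' : ℝ × ℝ) : M33 := if x' ∈ E then B else A

/-! ### Two-dimensional objects -/

abbrev Pt2 := ℝ × ℝ

/-- Directional partial derivative of a map `v : ℝ² → ℝ³`. -/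
def qd (e : Pt2) (v : Pt2 → V3) (y : Pt2) : V3 := fderiv ℝ v y e

def f1 : Pt2 := (1, 0)
def f2 : Pt2 := (0, 1)

/-- 𝒲(∇v) = W(∂₁v, 0, ∂₂v). -/
def W2 (W : M33 → ℝ) (v : Pt2 → V3) (y : Pt2) : ℝ := W ![qd f1 v y, 0, qd f2 v y]

/-- Squared 2D Hessian |∇²v|². -/
def hess2d (v : Pt2 → V3) (y : Pt2) : ℝ :=
  (vnorm (qd f1 (qd f1 v) y)) ^ 2 + 2 * (vnorm (qd f2 (qd f1 v) y)) ^ 2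
    + (vnorm (qd f2 (qd f2 v) y)) ^ 2

/-- The rectangle ℓI × γI. -/
def Rect (ℓ γ : ℝ) : Set Pt2 := Set.Ioo (-(ℓ / 2)) (ℓ / 2) ×ˢ Set.Ioo (-(γ / 2)) (γ / 2)

/-- The optimal-profile constant K_γ of the critical regime. -/
def Kgam (W : M33 → ℝ) (a A3 : V3) (γ : ℝ) : ℝ≥0∞ :=
  sInf { L : ℝ≥0∞ | ∃ ℓ > (0 : ℝ), ∃ v : Pt2 → V3,
    ContDiffOn ℝ 2 v (Rect ℓ γ) ∧
    (∃ δ > (0 : ℝ), ∀ y ∈ Rect ℓ γ, ℓ / 2 - δ < y.1 → qd f1 v y = a ∧ qd f2 v y = A3) ∧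
    (∃ δ > (0 : ℝ), ∀ y ∈ Rect ℓ γ, y.1 < -(ℓ / 2) + δ → qd f1 v y = -a ∧ qd f2 v y = -A3) ∧
    L = ENNReal.ofReal γ⁻¹ *
      ∫⁻ y in Rect ℓ γ, ENNReal.ofReal (W2 W v y + hess2d v y) }

/-- The 2D subcritical functional F⁰_ε(u, b, D). -/
def F0 (W : M33 → ℝ) (ε : ℝ) (u b : Pt2 → V3) (D : Set Pt2) : ℝ≥0∞ :=
  ∫⁻ y in D, ENNReal.ofReal (ε⁻¹ * W ![qd f1 u y, qd f2 u y, b y]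
    + ε * ((vnorm (qd f1 (qd f1 u) y)) ^ 2 + 2 * (vnorm (qd f2 (qd f1 u) y)) ^ 2
      + (vnorm (qd f2 (qd f2 u) y)) ^ 2
      + 2 * (vnorm (qd f1 b y)) ^ 2 + 2 * (vnorm (qd f2 b y)) ^ 2))

/-- K*₀: the subcritical cell constant. -/
def Kstar0 (W : M33 → ℝ) (a A3 : V3) : ℝ≥0∞ :=
  sInf { L : ℝ≥0∞ | ∃ (ε : ℕ → ℝ) (u b : ℕ → Pt2 → V3),
    (∀ n, 0 < ε n) ∧ Tendsto ε atTop (nhds 0) ∧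
    (∀ n, ContDiffOn ℝ 2 (u n) (II ×ˢ II)) ∧ (∀ n, ContDiffOn ℝ 1 (b n) (II ×ˢ II)) ∧
    Tendsto (fun n => ∫⁻ y in II ×ˢ II,
      ENNReal.ofReal (vnorm (u n y - ub0 a y.1) + vnorm (b n y - bb0 A3 y.1)))
      atTop (nhds 0) ∧
    L = Filter.liminf (fun n => F0 W (ε n) (u n) (b n) (II ×ˢ II)) atTop }

/-- K₀: the subcritical optimal-profile constant. -/
def K0 (W : M33 → ℝ) (a A3 : V3) : ℝ≥0∞ :=
  sInf { L : ℝ≥0∞ | ∃ ℓ > (0 : ℝ), ∃ φ1 φ2 : ℝ → V3,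
    ContDiffOn ℝ 1 φ1 (Set.Icc (-ℓ) ℓ) ∧ ContDiffOn ℝ 1 φ2 (Set.Icc (-ℓ) ℓ) ∧
    φ1 ℓ = a ∧ φ2 ℓ = A3 ∧ φ1 (-ℓ) = -a ∧ φ2 (-ℓ) = -A3 ∧
    L = ∫⁻ t in Set.Ioo (-ℓ) ℓ, ENNReal.ofReal (W ![φ1 t, 0, φ2 t]
      + (vnorm (derivWithin φ1 (Set.Icc (-ℓ) ℓ) t)) ^ 2
      + 2 * (vnorm (derivWithin φ2 (Set.Icc (-ℓ) ℓ) t)) ^ 2) }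

/-- K_∞ in the case λ = 0. -/
def KinfZero (W : M33 → ℝ) (a : V3) : ℝ≥0∞ :=
  sInf { L : ℝ≥0∞ | ∃ ℓ > (0 : ℝ), ∃ v : Pt2 → V3,
    ContDiff ℝ 2 v ∧ (∀ y : Pt2, v (y.1, y.2 + 1) = v y) ∧
    (∃ δ > (0 : ℝ), ∀ y : Pt2, |y.1 - 1 / 2| < δ → qd f1 v y = a ∧ qd f2 v y = 0) ∧
    (∃ δ > (0 : ℝ), ∀ y : Pt2, |y.1 + 1 / 2| < δ → qd f1 v y = -a ∧ qd f2 v y = 0) ∧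
    L = ∫⁻ y in II ×ˢ II, ENNReal.ofReal (ℓ * W2 W v y + ℓ⁻¹ * hess2d v y) }

/-- The unit normal ν_λ = (1+λ²)^{-1/2} (1, λ). -/
def nuv (lam : ℝ) : Pt2 := (1 / Real.sqrt (1 + lam ^ 2), lam / Real.sqrt (1 + lam ^ 2))

/-- The orthogonal direction ν_λ^⊥ = (1+λ²)^{-1/2} (−λ, 1). -/
def nupv (lam : ℝ) : Pt2 := (-lam / Real.sqrt (1 + lam ^ 2), 1 / Real.sqrt (1 + lam ^ 2))

/-- Dot product on ℝ². -/
def dotp (w y : Pt2) : ℝ := w.1 * y.1 + w.2 * y.2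

/-- The unit square Q'_λ centered at 0 with two sides orthogonal to ν_λ. -/
def Qlam (lam : ℝ) : Set Pt2 := {y | |dotp (nuv lam) y| < 1 / 2 ∧ |dotp (nupv lam) y| < 1 / 2}

/-- K_∞ for general λ. -/
def KinfL (W : M33 → ℝ) (a : V3) (lam : ℝ) : ℝ≥0∞ :=
  ENNReal.ofReal (Real.sqrt (1 + lam ^ 2)) *
    sInf { L : ℝ≥0∞ | ∃ ℓ > (0 : ℝ), ∃ v : Pt2 → V3,
      ContDiff ℝ 2 v ∧ (∀ y : Pt2, v (y + nupv lam) = v y) ∧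
      (∃ δ > (0 : ℝ), ∀ y : Pt2, |dotp (nuv lam) y - 1 / 2| < δ →
        qd f1 v y = a ∧ qd f2 v y = lam • a) ∧
      (∃ δ > (0 : ℝ), ∀ y : Pt2, |dotp (nuv lam) y + 1 / 2| < δ →
        qd f1 v y = -a ∧ qd f2 v y = -(lam • a)) ∧
      L = ∫⁻ y in Qlam lam, ENNReal.ofReal (ℓ * W2 W v y + ℓ⁻¹ * hess2d v y) }

/-- Number of interfaces strictly below t. -/
def cnt (m : ℕ) (α : Fin m → ℝ) (t : ℝ) : ℕ := (Finset.univ.filter (fun i => α i < t)).card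

end

/-- A Lipschitz function on an interval with a.e. vanishing derivative is constant. -/
theorem LipschitzOnWith.eq_of_ae_hasDerivAt_zero {E : Type*} [NormedAddCommGroup E]
    [NormedSpace ℝ E] {f : ℝ → E} {K : ℝ≥0} {a b s t : ℝ} (hf : LipschitzOnWith K f (Ioo a b))
    (h0 : ∀ᵐ r, r ∈ Ioo a b → HasDerivAt f 0 r) (hs : s ∈ Ioo a b) (ht : t ∈ Ioo a b) :
    f s = f t := by
  have hsub : uIcc s t ⊆ Ioo a b := ordConnected_Ioo.uIcc_subset hs ht
  obtain ⟨C, hC⟩ :=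
    (hf.mono hsub).absolutelyContinuousOnInterval.const_of_ae_hasDerivAt_zero
      (h0.mono fun r hr hmem => hr (hsub hmem))
  rw [hC s left_mem_uIcc, hC t right_mem_uIcc]

/-- A Lipschitz map on a box, independent of the third variable and with a.e. vanishing
derivative, is a.e. constant. -/
theorem exists_ae_eq_const_of_hasFDerivAt_zero {v : Pt → V3} {K : ℝ≥0} {p q c d : ℝ} {T : Set ℝ}
    (hpq : p < q) (hcd : c < d) (hT : IsOpen T) (hTne : T.Nonempty)
    (hv : LipschitzOnWith K v (Ioo p q ×ˢ (Ioo c d ×ˢ T)))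
    (hv3 : ∀ x₁ x₂ t t', v (x₁, x₂, t) = v (x₁, x₂, t'))
    (h0 : ∀ᵐ x : Pt, x ∈ Ioo p q ×ˢ (Ioo c d ×ˢ T) → HasFDerivAt v (0 : Pt →L[ℝ] V3) x) :
    ∃ C, ∀ᵐ x : Pt, x ∈ Ioo p q ×ˢ (Ioo c d ×ˢ T) → v x = C := by
  obtain ⟨t₀, ht₀⟩ := hTne
  obtain ⟨p₀, hp₀⟩ := nonempty_Ioo.2 hpq
  obtain ⟨y₀, hy₀, hy₀mem⟩ : ∃ y : ℝ × ℝ, (∀ᵐ s : ℝ, (s, y) ∈ Ioo p q ×ˢ (Ioo c d ×ˢ T) →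
      HasFDerivAt v (0 : Pt →L[ℝ] V3) (s, y)) ∧ y ∈ Ioo c d ×ˢ T := by
    have hsw : ∀ᵐ z : (ℝ × ℝ) × ℝ ∂((volume : Measure (ℝ × ℝ)).prod (volume : Measure ℝ)),
        z.swap ∈ Ioo p q ×ˢ (Ioo c d ×ˢ T) → HasFDerivAt v (0 : Pt →L[ℝ] V3) z.swap :=
      (Measure.measurePreserving_swap (μ := (volume : Measure (ℝ × ℝ)))
        (ν := (volume : Measure ℝ))).quasiMeasurePreserving.ae h0
    have hae := Measure.ae_ae_of_ae_prod hsw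
    obtain ⟨y, hyd, hyU⟩ := (Measure.dense_of_ae hae).exists_mem_open (isOpen_Ioo.prod hT)
      ((nonempty_Ioo.2 hcd).prod ⟨t₀, ht₀⟩)
    exact ⟨y, hyd, hyU⟩
  have hline : ∀ s ∈ Ioo p q, v (s, y₀) = v (p₀, y₀) := by
    intro s hs
    refine LipschitzOnWith.eq_of_ae_hasDerivAt_zero (f := fun s => v (s, y₀)) (K := K) (a := p)
      (b := q) ?_ ?_ hs hp₀
    · intro s hs t ht
      simpa [Prod.edist_eq] using hv (x := (s, y₀)) ⟨hs, hy₀mem⟩ (y := (t, y₀)) ⟨ht, hy₀mem⟩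
    · filter_upwards [hy₀] with r hr hmem
      simpa [Function.comp_def] using (hr ⟨hmem, hy₀mem⟩).comp_hasDerivAt r
        ((hasDerivAt_id r).prodMk (hasDerivAt_const r y₀))
  have hx₁ : ∀ᵐ x₁ : ℝ, x₁ ∈ Ioo p q → ∀ x₂ ∈ Ioo c d, v (x₁, x₂, t₀) = v (x₁, y₀.1, t₀) := by
    have hae : ∀ᵐ x₁ : ℝ, ∀ᵐ y : ℝ × ℝ, (x₁, y) ∈ Ioo p q ×ˢ (Ioo c d ×ˢ T) →
        HasFDerivAt v (0 : Pt →L[ℝ] V3) (x₁, y) := Measure.ae_ae_of_ae_prod h0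
    filter_upwards [hae] with x₁ hx₁ hmem x₂ hx₂
    refine LipschitzOnWith.eq_of_ae_hasDerivAt_zero (f := fun s => v (x₁, s, t₀)) (K := K) (a := c)
      (b := d) ?_ ?_ hx₂ hy₀mem.1
    · intro s hs t ht
      simpa [Prod.edist_eq] using hv (x := (x₁, s, t₀)) ⟨hmem, hs, ht₀⟩
        (y := (x₁, t, t₀)) ⟨hmem, ht, ht₀⟩
    · have hae₂ : ∀ᵐ r : ℝ, ∀ᵐ t : ℝ, (x₁, r, t) ∈ Ioo p q ×ˢ (Ioo c d ×ˢ T) →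
        HasFDerivAt v (0 : Pt →L[ℝ] V3) (x₁, r, t) := Measure.ae_ae_of_ae_prod hx₁
      filter_upwards [hae₂] with r hr hrmem
      obtain ⟨t, htd, htT⟩ := (Measure.dense_of_ae hr).exists_mem_open hT ⟨t₀, ht₀⟩
      have hd := (htd ⟨hmem, hrmem, htT⟩).comp_hasDerivAt r
        ((hasDerivAt_const r x₁).prodMk ((hasDerivAt_id r).prodMk (hasDerivAt_const r t)))
      have heq : (fun s => v (x₁, s, t₀)) = fun s => v (x₁, s, t) :=
        funext fun s => hv3 x₁ s t₀ t
      rw [heq]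
      simpa [Function.comp_def] using hd
  refine ⟨v (p₀, y₀), ?_⟩
  have hae : ∀ᵐ x : Pt, x.1 ∈ Ioo p q → ∀ x₂ ∈ Ioo c d, v (x.1, x₂, t₀) = v (x.1, y₀.1, t₀) :=
    Measure.quasiMeasurePreserving_fst.ae hx₁
  filter_upwards [hae] with x hx hmem
  calc v x = v (x.1, x.2.1, t₀) := hv3 _ _ _ _
    _ = v (x.1, y₀.1, t₀) := hx hmem.1 _ hmem.2.1
    _ = v (x.1, y₀) := hv3 _ _ _ _
    _ = v (p₀, y₀) := hline _ hmem.1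

theorem hasFDerivAt_abs_fst_sub {α : ℝ} {x : Pt} (hx : x.1 ≠ α) :
    HasFDerivAt (fun y : Pt => |y.1 - α|)
      ((SignType.sign (x.1 - α) : ℝ) • ContinuousLinearMap.fst ℝ ℝ (ℝ × ℝ)) x :=
  HasDerivAt.comp_hasFDerivAt (h₂ := fun t : ℝ => |t|) (f := fun y : Pt => y.1 - α) x
    (hasDerivAt_abs (sub_ne_zero.2 hx)) (hasFDerivAt_fst.sub_const α)

/-- A Lipschitz map whose planar gradient jumps between `σ a ⊗ e₁` and `-σ a ⊗ e₁` across
`x₁ = α` is a.e. of the form `σ |x₁ - α| a + C`. -/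
theorem exists_ae_eq_roof {u : Pt → V3} {K : ℝ≥0} {ρ α σ c d : ℝ} {a : V3} (hρ : 0 < ρ)
    (hcd : c < d) (hu : LipschitzOnWith K u (Ioo (α - ρ) (α + ρ) ×ˢ (Ioo c d ×ˢ II)))
    (hu3 : ∀ x₁ x₂ t t', u (x₁, x₂, t) = u (x₁, x₂, t'))
    (hgrad : ∀ᵐ x : Pt, x ∈ Ioo (α - ρ) (α + ρ) ×ˢ (Ioo c d ×ˢ II) →
      (α < x.1 → pd e1 u x = σ • a ∧ pd e2 u x = 0) ∧
      (x.1 < α → pd e1 u x = -(σ • a) ∧ pd e2 u x = 0)) :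
    ∃ C, ∀ᵐ x : Pt, x ∈ Ioo (α - ρ) (α + ρ) ×ˢ (Ioo c d ×ˢ II) →
      u x = (σ * |x.1 - α|) • a + C := by
  set S : Set Pt := Ioo (α - ρ) (α + ρ) ×ˢ (Ioo c d ×ˢ II)
  have hSo : IsOpen S := isOpen_Ioo.prod (isOpen_Ioo.prod isOpen_Ioo)
  have hroof : LipschitzOnWith (‖σ • a‖₊ * 1) (fun x : Pt => |x.1 - α| • σ • a) S := by
    refine LipschitzWith.lipschitzOnWith ?_
    refine LipschitzWith.of_dist_le_mul fun x y => ?_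
    rw [dist_eq_norm, ← sub_smul, norm_smul, mul_comm]
    simp only [mul_one, coe_nnnorm]
    gcongr
    refine (abs_abs_sub_abs_le _ _).trans ?_
    rw [sub_sub_sub_cancel_right, ← Real.dist_eq]
    exact le_max_left _ _
  obtain ⟨C, hC⟩ := exists_ae_eq_const_of_hasFDerivAt_zero (v := fun x => u x - |x.1 - α| • σ • a)
    (by linarith : α - ρ < α + ρ) hcd (isOpen_Ioo : IsOpen II) ⟨0, by norm_num [II]⟩
    (hu.sub hroof) (fun x₁ x₂ t t' => by simp only [hu3 x₁ x₂ t t']) (by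
      have hne : ∀ᵐ x : Pt, x.1 ≠ α :=
        Measure.quasiMeasurePreserving_fst.ae (Measure.ae_ne volume α)
      have : (volume : Measure Pt).IsAddHaarMeasure :=
        Measure.prod.instIsAddHaarMeasure _ _
      filter_upwards [hgrad, hne, hu.ae_differentiableWithinAt_of_mem (μ := volume)]
        with x hx hxα hxd hxS
      have hd := ((hxd hxS).differentiableAt (hSo.mem_nhds hxS)).hasFDerivAt
      have hd3 : fderiv ℝ u x e3 = 0 := by
        have hc := hd.comp_hasDerivAt_of_eq x.2.2 ((hasDerivAt_const x.2.2 x.1).prodMk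
          ((hasDerivAt_const x.2.2 x.2.1).prodMk (hasDerivAt_id x.2.2))) rfl
        have heq : (u ∘ fun t => (x.1, x.2.1, id t)) = fun _ => u x :=
          funext fun t => hu3 _ _ _ _
        rw [heq] at hc
        exact hc.unique (hasDerivAt_const _ _)
      have hsub := hd.sub ((hasFDerivAt_abs_fst_sub hxα).smul_const (σ • a))
      refine hsub.congr_fderiv (ContinuousLinearMap.ext fun y => ?_)
      have hy : y = y.1 • e1 + y.2.1 • e2 + y.2.2 • e3 := by
        ext <;> simp [e1, e2, e3]
      obtain ⟨h1, h2⟩ : pd e1 u x = (SignType.sign (x.1 - α) : ℝ) • σ • a ∧ pd e2 u x = 0 := by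
        rcases lt_or_gt_of_ne hxα with hlt | hgt
        · simpa [sign_neg (sub_neg.2 hlt)] using (hx hxS).2 hlt
        · simpa [sign_pos (sub_pos.2 hgt)] using (hx hxS).1 hgt
      unfold pd at h1 h2
      conv_lhs => rw [hy]
      simp only [map_add, map_smul, sub_apply, h1, h2, hd3]
      simp [e1, e2, e3])
  refine ⟨C, hC.mono fun x hx hxS => ?_⟩
  rw [← hx hxS, smul_smul, mul_comm σ]
  abel

theorem vnorm_smul (c : ℝ) (v : V3) : vnorm (c • v) = |c| * vnorm v := by
  simp only [vnorm, Pi.smul_apply, smul_eq_mul, mul_pow, ← Finset.mul_sum]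
  rw [Real.sqrt_mul (sq_nonneg c), Real.sqrt_sq_eq_abs]

theorem vnorm_smul_sq (c : ℝ) (v : V3) : vnorm (c • v) ^ 2 = c ^ 2 * vnorm v ^ 2 := by
  rw [vnorm_smul, mul_pow, sq_abs]

/-- The linear map scaling the first two variables by `τ` and the third one by `σ`. -/
noncomputable def scaleEquiv {τ σ : ℝ} (hτ : τ ≠ 0) (hσ : σ ≠ 0) : Pt ≃L[ℝ] Pt :=
  (ContinuousLinearEquiv.smulLeft (Units.mk0 τ hτ)).prodCongr
    ((ContinuousLinearEquiv.smulLeft (Units.mk0 τ hτ)).prodCongr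
      (ContinuousLinearEquiv.smulLeft (Units.mk0 σ hσ)))

theorem scaleEquiv_apply {τ σ : ℝ} (hτ : τ ≠ 0) (hσ : σ ≠ 0) (x : Pt) :
    scaleEquiv hτ hσ x = (τ * x.1, τ * x.2.1, σ * x.2.2) := rfl

theorem det_scaleEquiv {τ σ : ℝ} (hτ : τ ≠ 0) (hσ : σ ≠ 0) :
    (scaleEquiv hτ hσ : Pt →L[ℝ] Pt).det = τ * (τ * σ) := by
  have h : ((scaleEquiv hτ hσ : Pt →L[ℝ] Pt) : Pt →ₗ[ℝ] Pt) =
      (τ • LinearMap.id).prodMap ((τ • LinearMap.id).prodMap (σ • LinearMap.id)) := by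
    ext <;> simp [scaleEquiv_apply]
  rw [ContinuousLinearMap.det, h, LinearMap.det_prodMap, LinearMap.det_prodMap]
  simp

/-- The affine map scaling the first two variables by `τ`, the third one by `σ`, and mapping the
origin to `(α, β, 0)`. -/
def scaleMap (τ σ α β : ℝ) (x : Pt) : Pt := (τ * x.1 + α, τ * x.2.1 + β, σ * x.2.2)

theorem scaleMap_eq {τ σ : ℝ} (hτ : τ ≠ 0) (hσ : σ ≠ 0) (α β : ℝ) :
    scaleMap τ σ α β = fun x => scaleEquiv hτ hσ x + (α, β, 0) := by
  funext x
  simp [scaleMap, scaleEquiv_apply]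

theorem contDiff_scaleMap (τ σ α β : ℝ) : ContDiff ℝ 2 (scaleMap τ σ α β) := by
  unfold scaleMap
  fun_prop

theorem pd_sub_const (e : Pt) (w : Pt → V3) (C : V3) : pd e (fun x => w x - C) = pd e w := by
  funext x
  simp only [pd, fderiv_sub_const]

theorem pd_comp_scaleMap {τ σ : ℝ} (hτ : τ ≠ 0) (hσ : σ ≠ 0) (α β s : ℝ) (e : Pt)
    (w : Pt → V3) :
    pd e (fun x => s • w (scaleMap τ σ α β x)) =
      fun x => s • pd (scaleEquiv hτ hσ e) w (scaleMap τ σ α β x) := by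
  funext x
  have h₁ : fderiv ℝ (fun x => s • w (scaleMap τ σ α β x)) x =
      s • fderiv ℝ (fun x => w (scaleMap τ σ α β x)) x :=
    congrFun (fderiv_const_smul_field (f := fun x => w (scaleMap τ σ α β x)) s) x
  have h₂ : (fun x => w (scaleMap τ σ α β x)) =
      (fun y => w (y + (α, β, 0))) ∘ scaleEquiv hτ hσ := by
    rw [scaleMap_eq hτ hσ]
    rfl
  rw [pd, h₁, h₂, ContinuousLinearEquiv.comp_right_fderiv, fderiv_comp_add_right,
    scaleMap_eq hτ hσ]
  rfl

theorem pd_e1_comp_scaleMap {τ σ : ℝ} (hτ : τ ≠ 0) (hσ : σ ≠ 0) (α β s : ℝ) (w : Pt → V3) :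
    pd e1 (fun x => s • w (scaleMap τ σ α β x)) =
      fun x => (s * τ) • pd e1 w (scaleMap τ σ α β x) := by
  have he : scaleEquiv hτ hσ e1 = τ • e1 := by simp [scaleEquiv_apply, e1]
  simp only [pd_comp_scaleMap hτ hσ, he, pd, map_smul, smul_smul]

theorem pd_e2_comp_scaleMap {τ σ : ℝ} (hτ : τ ≠ 0) (hσ : σ ≠ 0) (α β s : ℝ) (w : Pt → V3) :
    pd e2 (fun x => s • w (scaleMap τ σ α β x)) =
      fun x => (s * τ) • pd e2 w (scaleMap τ σ α β x) := by
  have he : scaleEquiv hτ hσ e2 = τ • e2 := by simp [scaleEquiv_apply, e2]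
  simp only [pd_comp_scaleMap hτ hσ, he, pd, map_smul, smul_smul]

theorem pd_e3_comp_scaleMap {τ σ : ℝ} (hτ : τ ≠ 0) (hσ : σ ≠ 0) (α β s : ℝ) (w : Pt → V3) :
    pd e3 (fun x => s • w (scaleMap τ σ α β x)) =
      fun x => (s * σ) • pd e3 w (scaleMap τ σ α β x) := by
  have he : scaleEquiv hτ hσ e3 = σ • e3 := by simp [scaleEquiv_apply, e3]
  simp only [pd_comp_scaleMap hτ hσ, he, pd, map_smul, smul_smul]

/-- The blow-up of `w` at `(α, β)` at scale `l`, point-reflected if `σ = -1`. -/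
noncomputable def blowUp (l σ α β : ℝ) (C : V3) (w : Pt → V3) (x : Pt) : V3 :=
  (σ * l)⁻¹ • (w (scaleMap (σ * l) σ α β x) - C)

theorem pd_e1_blowUp {l σ : ℝ} (hl : 0 < l) (hσ : σ ^ 2 = 1) (α β : ℝ) (C : V3)
    (w : Pt → V3) :
    pd e1 (blowUp l σ α β C w) = fun x => pd e1 w (scaleMap (σ * l) σ α β x) := by
  have hσ0 : σ ≠ 0 := by rintro rfl; norm_num at hσ
  have hτ : σ * l ≠ 0 := mul_ne_zero hσ0 hl.ne'
  have h := pd_e1_comp_scaleMap hτ hσ0 α β (σ * l)⁻¹ (fun y => w y - C)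
  rw [pd_sub_const] at h
  simp only [inv_mul_cancel₀ hτ, one_smul] at h
  exact h

theorem pd_e2_blowUp {l σ : ℝ} (hl : 0 < l) (hσ : σ ^ 2 = 1) (α β : ℝ) (C : V3)
    (w : Pt → V3) :
    pd e2 (blowUp l σ α β C w) = fun x => pd e2 w (scaleMap (σ * l) σ α β x) := by
  have hσ0 : σ ≠ 0 := by rintro rfl; norm_num at hσ
  have hτ : σ * l ≠ 0 := mul_ne_zero hσ0 hl.ne'
  have h := pd_e2_comp_scaleMap hτ hσ0 α β (σ * l)⁻¹ (fun y => w y - C)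
  rw [pd_sub_const] at h
  simp only [inv_mul_cancel₀ hτ, one_smul] at h
  exact h

theorem pd_e3_blowUp {l σ : ℝ} (hl : 0 < l) (hσ : σ ^ 2 = 1) (α β : ℝ) (C : V3)
    (w : Pt → V3) :
    pd e3 (blowUp l σ α β C w) = fun x => l⁻¹ • pd e3 w (scaleMap (σ * l) σ α β x) := by
  have hσ0 : σ ≠ 0 := by rintro rfl; norm_num at hσ
  have hτ : σ * l ≠ 0 := mul_ne_zero hσ0 hl.ne'
  have h := pd_e3_comp_scaleMap hτ hσ0 α β (σ * l)⁻¹ (fun y => w y - C)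
  rw [pd_sub_const] at h
  have hc : (σ * l)⁻¹ * σ = l⁻¹ := by field_simp
  simp only [hc] at h
  exact h

theorem gradh_blowUp {l σ : ℝ} (hl : 0 < l) (hσ : σ ^ 2 = 1) (α β : ℝ) (C : V3)
    (w : Pt → V3) (h : ℝ) (x : Pt) :
    gradh (h / l) (blowUp l σ α β C w) x = gradh h w (scaleMap (σ * l) σ α β x) := by
  have hc : (h / l)⁻¹ * l⁻¹ = h⁻¹ := by field_simp
  simp only [gradh, pd_e1_blowUp hl hσ, pd_e2_blowUp hl hσ, pd_e3_blowUp hl hσ, smul_smul, hc]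

theorem hessh_blowUp {l σ : ℝ} (hl : 0 < l) (hσ : σ ^ 2 = 1) (α β : ℝ) (C : V3)
    (w : Pt → V3) {h : ℝ} (hh : 0 < h) (x : Pt) :
    hessh (h / l) (blowUp l σ α β C w) x = l ^ 2 * hessh h w (scaleMap (σ * l) σ α β x) := by
  have hσ0 : σ ≠ 0 := by rintro rfl; norm_num at hσ
  have hτ : σ * l ≠ 0 := mul_ne_zero hσ0 hl.ne'
  have key₁ (v : Pt → V3) : pd e1 (fun x => v (scaleMap (σ * l) σ α β x)) =
      fun x => (σ * l) • pd e1 v (scaleMap (σ * l) σ α β x) := by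
    simpa using pd_e1_comp_scaleMap hτ hσ0 α β 1 v
  have key₂ (v : Pt → V3) : pd e2 (fun x => v (scaleMap (σ * l) σ α β x)) =
      fun x => (σ * l) • pd e2 v (scaleMap (σ * l) σ α β x) := by
    simpa using pd_e2_comp_scaleMap hτ hσ0 α β 1 v
  have key₃ (v : Pt → V3) : pd e3 (fun x => v (scaleMap (σ * l) σ α β x)) =
      fun x => σ • pd e3 v (scaleMap (σ * l) σ α β x) := by
    simpa using pd_e3_comp_scaleMap hτ hσ0 α β 1 v
  simp only [hessh, pd_e1_blowUp hl hσ, pd_e2_blowUp hl hσ, pd_e3_blowUp hl hσ, key₁, key₂, key₃,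
    pd_e3_comp_scaleMap hτ hσ0, vnorm_smul_sq, mul_pow, hσ]
  field_simp

/-- The box of side lengths `l`, `l`, `1` centred at `(α, β, 0)`. -/
def cell (l α β : ℝ) : Set Pt :=
  Ioo (α - l / 2) (α + l / 2) ×ˢ (Ioo (β - l / 2) (β + l / 2) ×ˢ II)

theorem mapsTo_scaleMap_cell {l σ : ℝ} (hl : 0 < l) (hσ : σ = 1 ∨ σ = -1) (α β : ℝ) :
    MapsTo (scaleMap (σ * l) σ α β) (Jrho II 1) (cell l α β) := by
  rintro ⟨x, y, z⟩ ⟨⟨hx₁, hx₂⟩, ⟨hy₁, hy₂⟩, ⟨hz₁, hz₂⟩⟩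
  dsimp only at hx₁ hx₂ hy₁ hy₂ hz₁ hz₂
  rcases hσ with rfl | rfl <;>
  · refine ⟨⟨?_, ?_⟩, ⟨?_, ?_⟩, ⟨?_, ?_⟩⟩ <;> simp only [scaleMap] <;> nlinarith

theorem lintegral_comp_scaleMap_le {l σ : ℝ} (hl : 0 < l) (hσ : σ = 1 ∨ σ = -1) (α β : ℝ)
    (g : Pt → ℝ≥0∞) :
    ∫⁻ x in Jrho II 1, g (scaleMap (σ * l) σ α β x) ≤
      ENNReal.ofReal (l ^ 2)⁻¹ * ∫⁻ y in cell l α β, g y := by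
  have hσ0 : σ ≠ 0 := by rcases hσ with rfl | rfl <;> norm_num
  have hτ : σ * l ≠ 0 := mul_ne_zero hσ0 hl.ne'
  have hmeas : MeasurableSet (Jrho II 1) :=
    measurableSet_Ioo.prod (measurableSet_Ioo.prod measurableSet_Ioo)
  have : (volume : Measure Pt).IsAddHaarMeasure := Measure.prod.instIsAddHaarMeasure _ _
  have hinj : InjOn (scaleMap (σ * l) σ α β) (Jrho II 1) := by
    rw [scaleMap_eq hτ hσ0]
    exact fun x _ y _ hxy => (scaleEquiv hτ hσ0).injective (add_right_cancel hxy)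
  have hd : ∀ x ∈ Jrho II 1, HasFDerivWithinAt (scaleMap (σ * l) σ α β)
      (scaleEquiv hτ hσ0 : Pt →L[ℝ] Pt) (Jrho II 1) x := by
    rw [scaleMap_eq hτ hσ0]
    exact fun x _ => ((scaleEquiv hτ hσ0).hasFDerivAt.add_const _).hasFDerivWithinAt
  have hdet : |(scaleEquiv hτ hσ0 : Pt →L[ℝ] Pt).det| = l ^ 2 := by
    rw [det_scaleEquiv]
    rcases hσ with rfl | rfl
    · rw [abs_of_nonneg (by positivity)]; ring
    · rw [abs_of_nonpos (by nlinarith [sq_nonneg l])]; ring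
  have hcov := lintegral_image_eq_lintegral_abs_det_fderiv_mul volume hmeas hd hinj g
  rw [hdet, lintegral_const_mul' _ _ ENNReal.ofReal_ne_top] at hcov
  calc ∫⁻ x in Jrho II 1, g (scaleMap (σ * l) σ α β x)
      = ENNReal.ofReal (l ^ 2)⁻¹ *
          ∫⁻ y in scaleMap (σ * l) σ α β '' Jrho II 1, g y := by
        rw [hcov, ← mul_assoc, ← ENNReal.ofReal_mul (by positivity),
          inv_mul_cancel₀ (by positivity), ENNReal.ofReal_one, one_mul]
    _ ≤ _ := by
        gcongr
        exact (mapsTo_scaleMap_cell hl hσ α β).image_subset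

theorem F_blowUp_le {l σ h ε : ℝ} (hl : 0 < l) (hσ : σ = 1 ∨ σ = -1) (hh : 0 < h) (hε : 0 < ε)
    (α β : ℝ) (C : V3) (W : M33 → ℝ) (w : Pt → V3) :
    F W (h / l) (ε / l) (blowUp l σ α β C w) (Jrho II 1) ≤
      ENNReal.ofReal l⁻¹ * F W h ε w (cell l α β) := by
  have hσ2 : σ ^ 2 = 1 := by rcases hσ with rfl | rfl <;> norm_num
  have hpt (x : Pt) : ENNReal.ofReal ((ε / l)⁻¹ * W (gradh (h / l) (blowUp l σ α β C w) x) +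
      ε / l * hessh (h / l) (blowUp l σ α β C w) x) =
      (fun y => ENNReal.ofReal l * ENNReal.ofReal (ε⁻¹ * W (gradh h w y) + ε * hessh h w y))
        (scaleMap (σ * l) σ α β x) := by
    dsimp only
    rw [gradh_blowUp hl hσ2, hessh_blowUp hl hσ2 _ _ _ _ hh, ← ENNReal.ofReal_mul hl.le]
    congr 1
    field_simp
  simp only [F, hpt]
  refine (lintegral_comp_scaleMap_le hl hσ α β (fun y => ENNReal.ofReal l *
    ENNReal.ofReal (ε⁻¹ * W (gradh h w y) + ε * hessh h w y))).trans_eq ?_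
  rw [lintegral_const_mul' _ _ ENNReal.ofReal_ne_top, ← mul_assoc,
    ← ENNReal.ofReal_mul (by positivity)]
  congr 2
  field_simp

/-- Comparison of `L¹` distances on the unit cube and on a cell. -/
theorem tendsL1_of_comp_scaleMap {l σ k : ℝ} (hl : 0 < l) (hσ : σ = 1 ∨ σ = -1) (hk : 0 ≤ k)
    {α β : ℝ} {f f' : ℕ → Pt → V3} {g g' : Pt → V3} (hf : TendsL1 (cell l α β) f g)
    (hcomp : ∀ n, ∀ᵐ y : Pt, y ∈ cell l α β → ∀ x, scaleMap (σ * l) σ α β x = y →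
      vnorm (f' n x - g' x) = k * vnorm (f n y - g y)) :
    TendsL1 (Jrho II 1) f' g' := by
  have hσ0 : σ ≠ 0 := by rcases hσ with rfl | rfl <;> norm_num
  have hτ : σ * l ≠ 0 := mul_ne_zero hσ0 hl.ne'
  have hmeas : MeasurableSet (cell l α β) :=
    measurableSet_Ioo.prod (measurableSet_Ioo.prod measurableSet_Ioo)
  set T' : Pt → Pt := fun y => (scaleEquiv hτ hσ0).symm (y - (α, β, 0)) with hT'
  have hT'T (x : Pt) : T' (scaleMap (σ * l) σ α β x) = x := by
    rw [scaleMap_eq hτ hσ0, hT']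
    simp
  have hTT' (y : Pt) : scaleMap (σ * l) σ α β (T' y) = y := by
    rw [scaleMap_eq hτ hσ0, hT']
    simp
  have hle (n : ℕ) : ∫⁻ x in Jrho II 1, ENNReal.ofReal (vnorm (f' n x - g' x)) ≤
      ENNReal.ofReal (l ^ 2)⁻¹ * (ENNReal.ofReal k *
        ∫⁻ y in cell l α β, ENNReal.ofReal (vnorm (f n y - g y))) := by
    have h₁ := lintegral_comp_scaleMap_le hl hσ α β
      (fun y => ENNReal.ofReal (vnorm (f' n (T' y) - g' (T' y))))
    simp only [hT'T] at h₁
    refine h₁.trans_eq ?_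
    congr 1
    rw [← lintegral_const_mul' _ _ ENNReal.ofReal_ne_top]
    refine lintegral_congr_ae ?_
    rw [Filter.EventuallyEq, ae_restrict_iff' hmeas]
    filter_upwards [hcomp n] with y hy hmem
    rw [hy hmem _ (hTT' y), ENNReal.ofReal_mul hk]
  have hlim : Tendsto (fun n => ENNReal.ofReal (l ^ 2)⁻¹ * (ENNReal.ofReal k *
        ∫⁻ y in cell l α β, ENNReal.ofReal (vnorm (f n y - g y)))) atTop (nhds 0) := by
    simpa using ENNReal.Tendsto.const_mul
      (ENNReal.Tendsto.const_mul hf (Or.inr (ENNReal.ofReal_ne_top (r := k))))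
      (Or.inr (ENNReal.ofReal_ne_top (r := (l ^ 2)⁻¹)))
  exact tendsto_of_tendsto_of_tendsto_of_le_of_le tendsto_const_nhds hlim (fun _ => zero_le) hle

/-- The lower bound on a single cell, by blowing it up to the unit cube. -/
theorem Kstar_mul_le_liminf_cell {W : M33 → ℝ} {a A₃ C : V3} {γ l σ α β : ℝ} (hl : 0 < l)
    (hσ : σ = 1 ∨ σ = -1) {h ε : ℕ → ℝ} (hh : ∀ n, 0 < h n) (hε : ∀ n, 0 < ε n)
    (hh0 : Tendsto h atTop (nhds 0)) (hε0 : Tendsto ε atTop (nhds 0))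
    (hratio : Tendsto (fun n => h n / ε n) atTop (nhds γ))
    {un : ℕ → Pt → V3} {u b : Pt → V3} (hun : ∀ n, ContDiffOn ℝ 2 (un n) (cell l α β))
    (hu : ∀ᵐ x : Pt, x ∈ cell l α β → u x = (σ * |x.1 - α|) • a + C)
    (hb : ∀ᵐ x : Pt, x ∈ cell l α β →
      (α < x.1 → b x = σ • A₃) ∧ (x.1 < α → b x = -(σ • A₃)))
    (hL1u : TendsL1 (cell l α β) un u)
    (hL1b : TendsL1 (cell l α β) (fun n x => (h n)⁻¹ • pd e3 (un n) x) b) :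
    Kstar W a A₃ γ * ENNReal.ofReal l ≤
      liminf (fun n => F W (h n) (ε n) (un n) (cell l α β)) atTop := by
  have hσ2 : σ ^ 2 = 1 := by rcases hσ with rfl | rfl <;> norm_num
  have hσ0 : σ ≠ 0 := by rintro rfl; norm_num at hσ2
  have hτ : σ * l ≠ 0 := mul_ne_zero hσ0 hl.ne'
  have habsσ : |σ| = 1 := by rcases hσ with rfl | rfl <;> norm_num
  have hK : Kstar W a A₃ γ ≤ liminf (fun n => F W (h n / l) (ε n / l)
      (blowUp l σ α β C (un n)) (Jrho II 1)) atTop := by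
    refine sInf_le ⟨fun n => h n / l, fun n => ε n / l, fun n => blowUp l σ α β C (un n),
      fun n => div_pos (hh n) hl, fun n => div_pos (hε n) hl, by simpa using hh0.div_const l,
      by simpa using hε0.div_const l, ?_, ?_, ?_, ?_, rfl⟩
    · simpa only [div_div_div_cancel_right₀ hl.ne'] using hratio
    · intro n
      exact (((hun n).comp (contDiff_scaleMap _ _ _ _).contDiffOn
        (mapsTo_scaleMap_cell hl hσ α β)).sub contDiffOn_const).const_smul _
    · refine tendsL1_of_comp_scaleMap hl hσ (inv_nonneg.2 hl.le) hL1u fun n => ?_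
      filter_upwards [hu] with y hy hmem x hxy
      have hx : y.1 - α = σ * l * x.1 := by rw [← hxy]; simp [scaleMap]
      have hroof : u0 a x = (σ * l)⁻¹ • (u y - C) := by
        rw [hy hmem, add_sub_cancel_right, hx, smul_smul, u0, ub0, abs_mul, abs_mul, habsσ,
          abs_of_pos hl]
        congr 1
        field_simp
      rw [blowUp, hxy, hroof, ← smul_sub, sub_sub_sub_cancel_right, vnorm_smul, abs_inv, abs_mul,
        habsσ, abs_of_pos hl, one_mul]
    · refine tendsL1_of_comp_scaleMap hl hσ zero_le_one hL1b fun n => ?_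
      have hne : ∀ᵐ x : Pt, x.1 ≠ α :=
        Measure.quasiMeasurePreserving_fst.ae (Measure.ae_ne volume α)
      filter_upwards [hb, hne] with y hy hyα hmem x hxy
      have hx : y.1 - α = σ * l * x.1 := by rw [← hxy]; simp [scaleMap]
      have hjump : b0 A₃ x = b y := by
        rw [b0, bb0]
        rcases lt_or_gt_of_ne hyα with hlt | hgt
        · rw [(hy hmem).2 hlt]
          rcases hσ with rfl | rfl
          · rw [if_neg (by nlinarith), one_smul]
          · rw [if_pos (by nlinarith), neg_smul, one_smul, neg_neg]
        · rw [(hy hmem).1 hgt]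
          rcases hσ with rfl | rfl
          · rw [if_pos (by nlinarith), one_smul]
          · rw [if_neg (by nlinarith), neg_smul, one_smul]
      have hc : (h n / l)⁻¹ * l⁻¹ = (h n)⁻¹ := by
        have := (hh n).ne'
        field_simp
      simp only [pd_e3_blowUp hl hσ2, hxy, smul_smul, hc, hjump, one_mul]
  have hlim : Kstar W a A₃ γ ≤ ENNReal.ofReal l⁻¹ *
      liminf (fun n => F W (h n) (ε n) (un n) (cell l α β)) atTop := by
    rw [← ENNReal.liminf_const_mul_of_ne_top ENNReal.ofReal_ne_top]
    exact hK.trans (liminf_le_liminf (Eventually.of_forall fun n =>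
      F_blowUp_le hl hσ (hh n) (hε n) α β C W (un n)))
  calc Kstar W a A₃ γ * ENNReal.ofReal l
      ≤ ENNReal.ofReal l⁻¹ * liminf (fun n => F W (h n) (ε n) (un n) (cell l α β)) atTop *
          ENNReal.ofReal l := by gcongr
    _ = _ := by
        rw [mul_right_comm, ← ENNReal.ofReal_mul (by positivity), inv_mul_cancel₀ hl.ne',
          ENNReal.ofReal_one, one_mul]

theorem ENNReal.sum_liminf_le {ι : Type*} (s : Finset ι) (f : ι → ℕ → ℝ≥0∞) :
    ∑ i ∈ s, liminf (f i) atTop ≤ liminf (fun n => ∑ i ∈ s, f i n) atTop := by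
  classical
  let _ : MeasurableSpace s := ⊤
  have h := lintegral_liminf_le (u := (atTop : Filter ℕ)) (μ := (Measure.count : Measure s))
    (f := fun n (i : s) => f i n) (fun n => measurable_from_top)
  simpa only [lintegral_count, tsum_fintype, Finset.univ_eq_attach,
    Finset.sum_attach s (fun i => liminf (f i) atTop),
    fun n => Finset.sum_attach s (fun i => f i n)] using h

theorem TendsL1.mono {S S' : Set Pt} {f : ℕ → Pt → V3} {g : Pt → V3} (hf : TendsL1 S' f g)
    (hS : S ⊆ S') : TendsL1 S f g :=
  tendsto_of_tendsto_of_tendsto_of_le_of_le tendsto_const_nhds hf (fun _ => zero_le)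
    fun _ => lintegral_mono_set hS

/-- If each of finitely many disjoint measurable subsets of `S` carries at least the energy `k`
asymptotically, then so does `S` with the sum. -/
theorem card_mul_le_liminf_F {W : M33 → ℝ} {h ε : ℕ → ℝ} {un : ℕ → Pt → V3} {S : Set Pt}
    {N : ℕ} {D : ℕ → Set Pt} {k : ℝ≥0∞} (hD : ∀ i < N, D i ⊆ S)
    (hmeas : ∀ i, MeasurableSet (D i)) (hdisj : Pairwise (Function.onFun Disjoint D))
    (hk : ∀ i < N, k ≤ liminf (fun n => F W (h n) (ε n) (un n) (D i)) atTop) :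
    N * k ≤ liminf (fun n => F W (h n) (ε n) (un n) S) atTop := by
  calc (N : ℝ≥0∞) * k = ∑ i ∈ Finset.range N, k := by simp
    _ ≤ ∑ i ∈ Finset.range N, liminf (fun n => F W (h n) (ε n) (un n) (D i)) atTop :=
        Finset.sum_le_sum fun i hi => hk i (Finset.mem_range.1 hi)
    _ ≤ liminf (fun n => ∑ i ∈ Finset.range N, F W (h n) (ε n) (un n) (D i)) atTop :=
        ENNReal.sum_liminf_le _ _
    _ ≤ _ := by
        refine liminf_le_liminf (Eventually.of_forall fun n => ?_)
        simp only [F]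
        rw [← lintegral_biUnion_finset (fun i _ j _ hij => hdisj hij) (fun i _ => hmeas i)]
        exact lintegral_mono_set (iUnion₂_subset fun i hi => hD i (Finset.mem_range.1 hi))

/-- The cells of side length `l` whose second coordinates are consecutive intervals starting
at `c` are disjoint. -/
theorem pairwise_disjoint_cell {l : ℝ} (hl : 0 < l) (α c : ℝ) :
    Pairwise (Function.onFun Disjoint fun i : ℕ => cell l α (c + (i + 1 / 2) * l)) := by
  refine (pairwise_disjoint_on _).2 fun i j hij => Set.disjoint_left.2 ?_
  rintro x ⟨-, ⟨-, hxi⟩, -⟩ ⟨-, ⟨hxj, -⟩, -⟩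
  have hij' : (i : ℝ) + 1 ≤ j := by exact_mod_cast hij
  nlinarith

/-- Proposition 4.1, lower bound at a single interface. -/
theorem statement7 (p : ℝ) (hp : 2 ≤ p) (A B : M33) (W : M33 → ℝ) (a : V3)
    (hWc : Continuous W) (h1 : H1 W A B) (h2 : H2 W p)
    (hwells : Wells A B a) (γ : ℝ) (hγ : 0 < γ)
    (ρ αi : ℝ) (hρ : 0 < ρ) (c d : ℝ) (hcd : c < d)
    (U : Set Pt) (hU : U = Set.Ioo (αi - ρ) (αi + ρ) ×ˢ (Set.Ioo c d ×ˢ II))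
    (u b : Pt → V3) (K : NNReal) (hu : LipschitzOnWith K u U)
    (hbm : Measurable b) (hbbd : ∃ M : ℝ, ∀ x ∈ U, vnorm (b x) ≤ M)
    (hux3 : ∀ x₁ x₂ t t', u (x₁, x₂, t) = u (x₁, x₂, t'))
    (hbx3 : ∀ x₁ x₂ t t', b (x₁, x₂, t) = b (x₁, x₂, t'))
    (hjump : ∃ M N : M33, ((M = A ∧ N = B) ∨ (M = B ∧ N = A)) ∧
      ∀ᵐ x ∂(volume.restrict U),
        (αi < x.1 → pd e1 u x = M 0 ∧ pd e2 u x = M 1 ∧ b x = M 2) ∧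
        (x.1 < αi → pd e1 u x = N 0 ∧ pd e2 u x = N 1 ∧ b x = N 2))
    (h ε : ℕ → ℝ) (hh : ∀ n, 0 < h n) (hε : ∀ n, 0 < ε n)
    (hh0 : Tendsto h atTop (nhds 0)) (hε0 : Tendsto ε atTop (nhds 0))
    (hratio : Tendsto (fun n => h n / ε n) atTop (nhds γ))
    (un : ℕ → Pt → V3) (hun : ∀ n, ContDiffOn ℝ 2 (un n) U)
    (hL1u : TendsL1 U un u)
    (hL1b : TendsL1 U (fun n x => (h n)⁻¹ • pd e3 (un n) x) b) :
    Kstar W a (A 2) γ * volume (Set.Ioo c d) ≤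
      Filter.liminf (fun n => F W (h n) (ε n) (un n) U) atTop := by
  subst hU
  obtain ⟨hAB, hA0, hA1⟩ := hwells
  have hopen : IsOpen (Set.Ioo (αi - ρ) (αi + ρ) ×ˢ (Set.Ioo c d ×ˢ II)) :=
    isOpen_Ioo.prod (isOpen_Ioo.prod isOpen_Ioo)
  obtain ⟨σ, hσ, hgrad, hb⟩ : ∃ σ : ℝ, (σ = 1 ∨ σ = -1) ∧
      (∀ᵐ x : Pt, x ∈ Set.Ioo (αi - ρ) (αi + ρ) ×ˢ (Set.Ioo c d ×ˢ II) →
        (αi < x.1 → pd e1 u x = σ • a ∧ pd e2 u x = 0) ∧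
        (x.1 < αi → pd e1 u x = -(σ • a) ∧ pd e2 u x = 0)) ∧
      (∀ᵐ x : Pt, x ∈ Set.Ioo (αi - ρ) (αi + ρ) ×ˢ (Set.Ioo c d ×ˢ II) →
        (αi < x.1 → b x = σ • A 2) ∧ (x.1 < αi → b x = -(σ • A 2))) := by
    obtain ⟨M, N, hMN, hae⟩ := hjump
    rw [ae_restrict_iff' hopen.measurableSet] at hae
    have hB : B = -A := by rw [hAB, neg_neg]
    rcases hMN with ⟨rfl, rfl⟩ | ⟨rfl, rfl⟩
    · refine ⟨1, Or.inl rfl, ?_, ?_⟩ <;> filter_upwards [hae] with x hx hmem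
      · have := hx hmem
        simp only [hB, Pi.neg_apply, hA0, hA1, neg_zero] at this
        simp only [one_smul]
        tauto
      · have := hx hmem
        simp only [hB, Pi.neg_apply] at this
        simp only [one_smul]
        tauto
    · refine ⟨-1, Or.inr rfl, ?_, ?_⟩ <;> filter_upwards [hae] with x hx hmem
      · have := hx hmem
        simp only [hB, Pi.neg_apply, hA0, hA1, neg_zero] at this
        simp only [neg_smul, one_smul, neg_neg]
        tauto
      · have := hx hmem
        simp only [hB, Pi.neg_apply] at this
        simp only [neg_smul, one_smul, neg_neg]
        tauto
  obtain ⟨C, hC⟩ := exists_ae_eq_roof hρ hcd hu hux3 hgrad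
  obtain ⟨m, hm⟩ := exists_nat_gt ((d - c) / (2 * ρ))
  have hdc : 0 < d - c := sub_pos.2 hcd
  have hm0 : (0 : ℝ) < m := lt_trans (by positivity) hm
  set l : ℝ := (d - c) / m with hl_def
  have hl : 0 < l := by positivity
  have hml : m * l = d - c := by rw [hl_def]; field_simp
  have hlρ : l ≤ 2 * ρ := by
    rw [div_lt_iff₀ (by positivity)] at hm
    rw [hl_def, div_le_iff₀ hm0]
    linarith
  have hsub : ∀ i < m, cell l αi (c + ((i : ℝ) + 1 / 2) * l) ⊆
      Set.Ioo (αi - ρ) (αi + ρ) ×ˢ (Set.Ioo c d ×ˢ II) := by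
    intro i hi
    have him : (i : ℝ) + 1 ≤ m := by exact_mod_cast hi
    have hi0 : (0 : ℝ) ≤ i * l := by positivity
    have hil : ((i : ℝ) + 1) * l ≤ m * l := by gcongr
    refine prod_mono (Ioo_subset_Ioo ?_ ?_) (prod_mono (Ioo_subset_Ioo ?_ ?_) subset_rfl) <;>
      linarith
  calc Kstar W a (A 2) γ * volume (Set.Ioo c d)
      = m * (Kstar W a (A 2) γ * ENNReal.ofReal l) := by
        rw [Real.volume_Ioo, ← hml, ENNReal.ofReal_mul hm0.le, ENNReal.ofReal_natCast,
          mul_left_comm]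
    _ ≤ _ := by
        refine card_mul_le_liminf_F hsub
          (fun i => measurableSet_Ioo.prod (measurableSet_Ioo.prod measurableSet_Ioo))
          (pairwise_disjoint_cell hl αi c) fun i hi => ?_
        exact Kstar_mul_le_liminf_cell hl hσ hh hε hh0 hε0 hratio
          (fun n => (hun n).mono (hsub i hi)) (hC.mono fun x hx hmem => hx (hsub i hi hmem))
          (hb.mono fun x hx hmem => hx (hsub i hi hmem)) (hL1u.mono (hsub i hi))
          (hL1b.mono (hsub i hi))
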